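/- arXiv:1505.04924 — 2 statements merged into one kernel-verified Lean document; each statement's English description precedes it below -/
import Mathlib

section
/- Let H ∈ (0,1), n ≥ 1 an integer, and t > 0. Then ∫_{T_n(t)} ∏_{j=2}^{n+1} (s_j − s_{j−1})^{H−1} ds_1 ⋯ ds_n = Γ(H)^n t^{nH} / Γ(nH + 1), where s_{n+1} = t, T_n(t) = {(s_1,…,s_n) ∈ ℝ^n : 0 < s_1 < ⋯ < s_n < t}, and Γ is the Gamma function. -/
open MeasureTheory

/-- `prevCoord s i` is `s_{i-1}`, with the convention `s_0 = 0`. -/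
def prevCoord {n : ℕ} (s : Fin n → ℝ) (i : Fin n) : ℝ :=
  if _h : (i : ℕ) = 0 then 0
  else s ⟨(i : ℕ) - 1, lt_of_le_of_lt (Nat.sub_le _ _) i.isLt⟩

/-- `nextCoord t s i` is `s_{i+1}`, with the convention `s_{n+1} = t`. -/
def nextCoord {n : ℕ} (t : ℝ) (s : Fin n → ℝ) (i : Fin n) : ℝ :=
  if h : (i : ℕ) + 1 < n then s ⟨(i : ℕ) + 1, h⟩ else t

/-- The open simplex `T_n(t) = {0 < s_1 < ⋯ < s_n < t}`. -/
def simplex (n : ℕ) (t : ℝ) : Set (Fin n → ℝ) :=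
  {s | ∀ i, prevCoord s i < s i ∧ s i < t}

theorem simplex_zero (t : ℝ) : simplex 0 t = Set.univ :=
  Set.eq_univ_of_forall fun _ i => i.elim0

theorem prevCoord_snoc_castSucc {n : ℕ} (s : Fin n → ℝ) (r : ℝ) (i : Fin n) :
    prevCoord (Fin.snoc s r : Fin (n + 1) → ℝ) i.castSucc = prevCoord s i := by
  unfold prevCoord
  by_cases h : (i : ℕ) = 0
  · simp [h]
  · have h' : (i : ℕ) - 1 < n := by omega
    simp [h, Fin.snoc, h']

theorem nextCoord_snoc_castSucc {n : ℕ} (s : Fin n → ℝ) (r t : ℝ) (i : Fin n) :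
    nextCoord t (Fin.snoc s r : Fin (n + 1) → ℝ) i.castSucc = nextCoord r s i := by
  unfold nextCoord
  by_cases h : (i : ℕ) + 1 < n <;> simp [h, Fin.snoc]

theorem nextCoord_snoc_last {n : ℕ} (s : Fin n → ℝ) (r t : ℝ) :
    nextCoord t (Fin.snoc s r : Fin (n + 1) → ℝ) (Fin.last n) = t := by
  simp [nextCoord]

/-- The coordinates of a point of the simplex are positive. -/
theorem pos_of_forall_prevCoord_lt {n : ℕ} {s : Fin n → ℝ} (hs : ∀ i, prevCoord s i < s i)
    (i : Fin n) : 0 < s i := by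
  obtain ⟨k, hk⟩ := i
  induction k with
  | zero => simpa [prevCoord] using hs ⟨0, hk⟩
  | succ k ih => exact (ih (by omega)).trans (by simpa [prevCoord] using hs ⟨k + 1, hk⟩)

theorem strictMono_of_forall_prevCoord_lt {n : ℕ} {s : Fin (n + 1) → ℝ}
    (hs : ∀ i, prevCoord s i < s i) : StrictMono s := by
  rw [Fin.strictMono_iff_lt_succ]
  intro i
  simpa [prevCoord, Fin.castSucc, Fin.castAdd, Fin.castLE] using hs i.succ

theorem snoc_mem_simplex_iff {n : ℕ} (s : Fin n → ℝ) (r t : ℝ) :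
    (Fin.snoc s r : Fin (n + 1) → ℝ) ∈ simplex (n + 1) t ↔
      r ∈ Set.Ioo 0 t ∧ s ∈ simplex n r := by
  constructor
  · intro h
    have hp := fun i => (h i).1
    have hlast := (h (Fin.last n)).2
    have hpos := pos_of_forall_prevCoord_lt hp (Fin.last n)
    rw [Fin.snoc_last] at hlast hpos
    refine ⟨⟨hpos, hlast⟩, fun i => ⟨?_, ?_⟩⟩
    · simpa [prevCoord_snoc_castSucc] using hp i.castSucc
    · simpa using strictMono_of_forall_prevCoord_lt hp (Fin.castSucc_lt_last i)
  · rintro ⟨⟨hr, hrt⟩, hs⟩ i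
    induction i using Fin.lastCases with
    | last =>
      refine ⟨?_, by simpa using hrt⟩
      rw [Fin.snoc_last]
      by_cases h : n = 0
      · simpa [prevCoord, h] using hr
      · have h' : n - 1 < n := by omega
        simpa [prevCoord, h, Fin.snoc, h'] using (hs ⟨n - 1, h'⟩).2
    | cast i =>
      rw [prevCoord_snoc_castSucc, Fin.snoc_castSucc]
      exact ⟨(hs i).1, (hs i).2.trans hrt⟩

theorem measurable_prevCoord {n : ℕ} (i : Fin n) :
    Measurable fun s : Fin n → ℝ => prevCoord s i := by
  unfold prevCoord
  split_ifs <;> fun_prop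

theorem measurable_nextCoord {n : ℕ} (t : ℝ) (i : Fin n) :
    Measurable fun s : Fin n → ℝ => nextCoord t s i := by
  unfold nextCoord
  split_ifs <;> fun_prop

theorem measurableSet_simplex (n : ℕ) (t : ℝ) : MeasurableSet (simplex n t) := by
  have : simplex n t = ⋂ i, {s | prevCoord s i < s i} ∩ {s | s i < t} := by
    ext s; simp [simplex]
  rw [this]
  exact MeasurableSet.iInter fun i =>
    (measurableSet_lt (measurable_prevCoord i) (measurable_pi_apply i)).inter
      (measurableSet_lt (measurable_pi_apply i) measurable_const)

/-- Integration over the simplex `T_{n+1}(t)` by slicing along the last coordinate. -/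
theorem lintegral_simplex_succ (n : ℕ) (t : ℝ) {f : (Fin (n + 1) → ℝ) → ENNReal}
    (hf : Measurable f) :
    ∫⁻ s in simplex (n + 1) t, f s =
      ∫⁻ r in Set.Ioo 0 t, ∫⁻ s in simplex n r, f (Fin.snoc s r) := by
  have hS := measurableSet_simplex (n + 1) t
  have e := (volume_preserving_piFinSuccAbove (fun _ : Fin (n + 1) => ℝ) (Fin.last n)).symm
  rw [← lintegral_indicator hS, ← e.lintegral_comp (hf.indicator hS), Measure.volume_eq_prod,
    lintegral_prod (fun z => (simplex (n + 1) t).indicator f (_ : Fin (n + 1) → ℝ))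
      ((hf.indicator hS).comp e.measurable).aemeasurable,
    ← lintegral_indicator measurableSet_Ioo]
  refine lintegral_congr fun r => ?_
  have key : ∀ s : Fin n → ℝ,
      (MeasurableEquiv.piFinSuccAbove (fun _ : Fin (n + 1) => ℝ) (Fin.last n)).symm (r, s) =
        (Fin.snoc s r : Fin (n + 1) → ℝ) := fun s => by
    simp [MeasurableEquiv.piFinSuccAbove, Fin.insertNthEquiv, Fin.insertNth_last']
  simp only [key]
  by_cases hr : r ∈ Set.Ioo 0 t
  · rw [Set.indicator_of_mem hr, ← lintegral_indicator (measurableSet_simplex n r)]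
    refine lintegral_congr fun s => ?_
    have hiff := snoc_mem_simplex_iff s r t
    by_cases hs : s ∈ simplex n r
    · rw [Set.indicator_of_mem hs, Set.indicator_of_mem (hiff.2 ⟨hr, hs⟩)]
    · rw [Set.indicator_of_notMem hs, Set.indicator_of_notMem fun h => hs (hiff.1 h).2]
  · simp [Set.indicator, snoc_mem_simplex_iff, hr]

theorem integral_rpow_mul_sub_rpow {a b t : ℝ} (ha : 0 < a) (hb : 0 < b) (ht : 0 < t) :
    ∫ x in (0 : ℝ)..t, x ^ (a - 1) * (t - x) ^ (b - 1) =
      t ^ (a + b - 1) * (Real.Gamma a * Real.Gamma b / Real.Gamma (a + b)) := by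
  have h := Complex.betaIntegral_scaled a b ht
  rw [Complex.betaIntegral_eq_Gamma_mul_div a b (by simpa) (by simpa)] at h
  apply Complex.ofReal_injective
  rw [← intervalIntegral.integral_ofReal]
  push_cast [Complex.ofReal_cpow ht.le, ← Complex.Gamma_ofReal]
  rw [← h]
  refine intervalIntegral.integral_congr fun x hx => ?_
  rw [Set.uIcc_of_le ht.le] at hx
  rw [Complex.ofReal_cpow hx.1, Complex.ofReal_cpow (sub_nonneg.2 hx.2)]
  push_cast
  rfl

theorem lintegral_rpow_mul_sub_rpow {a b t : ℝ} (ha : 0 < a) (hb : 0 < b) (ht : 0 < t) :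
    ∫⁻ x in Set.Ioo 0 t, ENNReal.ofReal (x ^ (a - 1) * (t - x) ^ (b - 1)) =
      ENNReal.ofReal
        (t ^ (a + b - 1) * (Real.Gamma a * Real.Gamma b / Real.Gamma (a + b))) := by
  have h := integral_rpow_mul_sub_rpow ha hb ht
  have hint : IntervalIntegrable (fun x => x ^ (a - 1) * (t - x) ^ (b - 1)) volume 0 t := by
    by_contra hn
    rw [intervalIntegral.integral_undef hn] at h
    have := Real.Gamma_pos_of_pos ha
    have := Real.Gamma_pos_of_pos hb
    have := Real.Gamma_pos_of_pos (add_pos ha hb)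
    exact absurd h (by positivity)
  rw [intervalIntegrable_iff_integrableOn_Ioo_of_le ht.le] at hint
  rw [← h, intervalIntegral.integral_of_le ht.le, integral_Ioc_eq_integral_Ioo,
    ofReal_integral_eq_lintegral_ofReal hint]
  filter_upwards [ae_restrict_mem measurableSet_Ioo] with x hx
  exact mul_nonneg (Real.rpow_nonneg hx.1.le _) (Real.rpow_nonneg (sub_nonneg.2 hx.2.le) _)

theorem lintegral_simplex_prod_rpow {H : ℝ} (hH : 0 < H) (n : ℕ) {t : ℝ} (ht : 0 < t) :
    (∫⁻ s in simplex n t, ENNReal.ofReal (∏ i, (nextCoord t s i - s i) ^ (H - 1))) =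
      ENNReal.ofReal
        (Real.Gamma H ^ n * t ^ ((n : ℝ) * H) / Real.Gamma ((n : ℝ) * H + 1)) := by
  induction n generalizing t with
  | zero => simp [simplex_zero, volume_pi]
  | succ n ih =>
    have hmeas : Measurable fun s : Fin (n + 1) → ℝ =>
        ENNReal.ofReal (∏ i, (nextCoord t s i - s i) ^ (H - 1)) :=
      ENNReal.measurable_ofReal.comp <| Finset.measurable_fun_prod _ fun i _ =>
        ((measurable_nextCoord t i).sub (measurable_pi_apply i)).pow_const _
    have hn : 0 < (n : ℝ) * H + 1 := by positivity
    have hG := Real.Gamma_pos_of_pos hH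
    have hGn := Real.Gamma_pos_of_pos hn
    have hC : 0 ≤ Real.Gamma H ^ n / Real.Gamma ((n : ℝ) * H + 1) := by positivity
    rw [lintegral_simplex_succ n t hmeas]
    calc
      _ = ∫⁻ r in Set.Ioo 0 t,
            ENNReal.ofReal (Real.Gamma H ^ n / Real.Gamma ((n : ℝ) * H + 1)) *
            ENNReal.ofReal (r ^ ((n : ℝ) * H + 1 - 1) * (t - r) ^ (H - 1)) := by
        refine setLIntegral_congr_fun measurableSet_Ioo fun r hr => ?_
        have hr0 : 0 ≤ (t - r) ^ (H - 1) := Real.rpow_nonneg (sub_nonneg.2 hr.2.le) _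
        simp only [Fin.prod_univ_castSucc, nextCoord_snoc_castSucc, nextCoord_snoc_last,
          Fin.snoc_castSucc, Fin.snoc_last, ENNReal.ofReal_mul' hr0]
        rw [lintegral_mul_const' _ _ ENNReal.ofReal_ne_top, ih hr.1, ← ENNReal.ofReal_mul' hr0,
          ← ENNReal.ofReal_mul' hr0, ← ENNReal.ofReal_mul hC, add_sub_cancel_right]
        congr 1
        ring
      _ = _ := by
        rw [lintegral_const_mul' _ _ ENNReal.ofReal_ne_top,
          lintegral_rpow_mul_sub_rpow hn hH ht, ← ENNReal.ofReal_mul hC]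
        congr 1
        have h1 : (n : ℝ) * H + 1 + H = ((n + 1 : ℕ) : ℝ) * H + 1 := by push_cast; ring
        rw [h1, add_sub_cancel_right]
        field_simp
        ring

/-- For `H ∈ (0,1)`, `n ≥ 1` and `t > 0`,
`∫_{T_n(t)} ∏_{j=2}^{n+1} (s_j - s_{j-1})^{H-1} ds = Γ(H)^n t^{nH} / Γ(nH+1)`,
where `s_{n+1} = t`. -/
theorem stmt_16 (H : ℝ) (hH : H ∈ Set.Ioo (0:ℝ) 1) (n : ℕ) (hn : 1 ≤ n)
    (t : ℝ) (ht : 0 < t) :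
    (∫⁻ s in simplex n t, ENNReal.ofReal (∏ i, (nextCoord t s i - s i) ^ (H - 1)))
      = ENNReal.ofReal
          (Real.Gamma H ^ n * t ^ ((n : ℝ) * H) / Real.Gamma ((n : ℝ) * H + 1)) := by
  exact lintegral_simplex_prod_rpow hH.1 n ht
end

section
/- Let H ∈ (0,1/2). There exists a finite constant C_H, depending only on H, such that for every κ > 0 and all 0 ≤ t_1 ≤ t_2, ∫_0^{t_1} ∫_ℝ ( e^{−κ(t_2−s)ξ²/2} − e^{−κ(t_1−s)ξ²/2} )² |ξ|^{1−2H} dξ ds ≤ C_H κ^{H−1} (t_2 − t_1)^H. -/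
open MeasureTheory Real

/-- The integral over `ℝ` of a function of `|x|` is twice its integral over `(0, ∞)`. -/
theorem lintegral_comp_abs_eq_two_mul (f : ℝ → ENNReal) :
    ∫⁻ x : ℝ, f |x| = 2 * ∫⁻ x in Set.Ioi (0 : ℝ), f x := by
  have hpos : ∫⁻ x in Set.Ioi (0 : ℝ), f |x| = ∫⁻ x in Set.Ioi (0 : ℝ), f x :=
    setLIntegral_congr_fun measurableSet_Ioi fun x hx => by
      rw [abs_of_pos (Set.mem_Ioi.mp hx)]
  have hneg : ∫⁻ x in Set.Iic (0 : ℝ), f |x| = ∫⁻ x in Set.Ioi (0 : ℝ), f x := by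
    rw [← hpos, setLIntegral_congr Ioi_ae_eq_Ici,
      ← (Measure.measurePreserving_neg (volume : Measure ℝ)).setLIntegral_comp_preimage_emb
        (MeasurableEquiv.neg ℝ).measurableEmbedding (fun x => f |x|) (Set.Ici 0)]
    simp
  rw [← lintegral_add_compl (fun x : ℝ => f |x|) (measurableSet_Ioi (a := (0 : ℝ))),
    Set.compl_Ioi, hpos, hneg, two_mul]

theorem setLIntegral_exp_neg_mul_sub_le {b : ℝ} (hb : 0 < b) (t : ℝ) :
    ∫⁻ s in Set.Icc 0 t, ENNReal.ofReal (exp (-(b * (t - s)))) ≤ ENNReal.ofReal b⁻¹ := by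
  have hexp : (fun s : ℝ => exp (-(b * (t - s)))) = fun s => exp (-(b * t)) * exp (b * s) := by
    funext s
    rw [← exp_add]
    ring_nf
  calc ∫⁻ s in Set.Icc 0 t, ENNReal.ofReal (exp (-(b * (t - s))))
      ≤ ∫⁻ s in Set.Iic t, ENNReal.ofReal (exp (-(b * (t - s)))) :=
        lintegral_mono_set Set.Icc_subset_Iic_self
    _ = ENNReal.ofReal (∫ s in Set.Iic t, exp (-(b * (t - s)))) := by
        rw [ofReal_integral_eq_lintegral_ofReal]
        · rw [hexp]
          exact (integrableOn_exp_mul_Iic hb t).const_mul _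
        · exact Filter.Eventually.of_forall fun s => (exp_pos _).le
    _ = ENNReal.ofReal b⁻¹ := by
        rw [hexp, integral_const_mul, integral_exp_mul_Iic hb, ← mul_div_assoc, ← exp_add]
        simp

theorem one_sub_exp_neg_sq_le_min {x : ℝ} (hx : 0 ≤ x) : (1 - exp (-x)) ^ 2 ≤ min 1 x := by
  have h0 : 0 ≤ 1 - exp (-x) := by simpa using hx
  have h1 : 1 - exp (-x) ≤ 1 := by linarith [exp_pos (-x)]
  have h2 : 1 - exp (-x) ≤ x := by linarith [add_one_le_exp (-x)]
  exact le_min (by nlinarith) (by nlinarith)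

theorem setLIntegral_min_one_mul_rpow_le {H : ℝ} (hH0 : 0 < H) (hH1 : H < 1) {c : ℝ}
    (hc : 0 < c) :
    ∫⁻ x in Set.Ioi (0 : ℝ), ENNReal.ofReal (min 1 (c * x ^ 2) * x ^ (-1 - 2 * H)) ≤
      ENNReal.ofReal ((1 / (2 - 2 * H) + 1 / (2 * H)) * c ^ H) := by
  set a : ℝ := c ^ (-(1 / 2) : ℝ) with ha
  have ha0 : 0 < a := rpow_pos_of_pos hc _
  have hsmall : ∫⁻ x in Set.Ioc 0 a, ENNReal.ofReal (min 1 (c * x ^ 2) * x ^ (-1 - 2 * H)) ≤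
      ENNReal.ofReal (1 / (2 - 2 * H) * c ^ H) := by
    have hint : IntegrableOn (fun x : ℝ => c * x ^ (1 - 2 * H)) (Set.Ioc 0 a) :=
      ((intervalIntegrable_iff_integrableOn_Ioc_of_le ha0.le).mp
        (intervalIntegral.intervalIntegrable_rpow' (by linarith))).const_mul c
    calc ∫⁻ x in Set.Ioc 0 a, ENNReal.ofReal (min 1 (c * x ^ 2) * x ^ (-1 - 2 * H))
        ≤ ∫⁻ x in Set.Ioc 0 a, ENNReal.ofReal (c * x ^ (1 - 2 * H)) := by
          refine setLIntegral_mono' measurableSet_Ioc fun x hx => ENNReal.ofReal_le_ofReal ?_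
          calc min 1 (c * x ^ 2) * x ^ (-1 - 2 * H) ≤ c * x ^ 2 * x ^ (-1 - 2 * H) :=
                mul_le_mul_of_nonneg_right (min_le_right _ _) (rpow_nonneg hx.1.le _)
            _ = c * x ^ (1 - 2 * H) := by
                rw [mul_assoc, ← rpow_natCast, ← rpow_add hx.1]
                congr 2
                push_cast
                ring
      _ = ENNReal.ofReal (∫ x in Set.Ioc 0 a, c * x ^ (1 - 2 * H)) := by
          rw [ofReal_integral_eq_lintegral_ofReal hint]
          exact (ae_restrict_iff' measurableSet_Ioc).mpr <| Filter.Eventually.of_forall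
            fun x hx => mul_nonneg hc.le (rpow_nonneg hx.1.le _)
      _ = ENNReal.ofReal (1 / (2 - 2 * H) * c ^ H) := by
          rw [integral_const_mul, ← intervalIntegral.integral_of_le ha0.le,
            integral_rpow (Or.inl (by linarith)), zero_rpow (by linarith), sub_zero, ha,
            ← rpow_mul hc.le]
          have hpow : c ^ H = c * c ^ (-(1 / 2) * (1 - 2 * H + 1)) := by
            nth_rw 2 [← rpow_one c]
            rw [← rpow_add hc]
            ring_nf
          rw [hpow]
          ring_nf
  have hlarge : ∫⁻ x in Set.Ioi a, ENNReal.ofReal (min 1 (c * x ^ 2) * x ^ (-1 - 2 * H)) ≤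
      ENNReal.ofReal (1 / (2 * H) * c ^ H) := by
    calc ∫⁻ x in Set.Ioi a, ENNReal.ofReal (min 1 (c * x ^ 2) * x ^ (-1 - 2 * H))
        ≤ ∫⁻ x in Set.Ioi a, ENNReal.ofReal (x ^ (-1 - 2 * H)) := by
          refine setLIntegral_mono' measurableSet_Ioi fun x hx => ENNReal.ofReal_le_ofReal ?_
          exact mul_le_of_le_one_left (rpow_nonneg (ha0.trans hx).le _) (min_le_left _ _)
      _ = ENNReal.ofReal (∫ x in Set.Ioi a, x ^ (-1 - 2 * H)) := by
          rw [ofReal_integral_eq_lintegral_ofReal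
            (integrableOn_Ioi_rpow_of_lt (by linarith) ha0)]
          exact (ae_restrict_iff' measurableSet_Ioi).mpr <| Filter.Eventually.of_forall
            fun x hx => rpow_nonneg (ha0.trans hx).le _
      _ = ENNReal.ofReal (1 / (2 * H) * c ^ H) := by
          rw [integral_Ioi_rpow_of_lt (by linarith) ha0, ha, ← rpow_mul hc.le,
            show -(1 / 2) * (-1 - 2 * H + 1) = H by ring, show -1 - 2 * H + 1 = -(2 * H) by ring,
            neg_div_neg_eq, one_div_mul_eq_div]
  have h2 : 0 < 2 - 2 * H := by linarith
  rw [← Set.Ioc_union_Ioi_eq_Ioi ha0.le, add_mul, ENNReal.ofReal_add (by positivity)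
    (by positivity)]
  exact (lintegral_union_le _ _ _).trans (add_le_add hsmall hlarge)

/-- Integrating the squared difference of the two heat multipliers in time. -/
theorem setLIntegral_exp_sub_exp_sq_le {H κ t₁ t₂ : ℝ} (hκ : 0 < κ) (ht : t₁ ≤ t₂) (ξ : ℝ) :
    ∫⁻ s in Set.Icc 0 t₁, ENNReal.ofReal
        ((exp (-(κ * (t₂ - s) * ξ ^ 2) / 2) - exp (-(κ * (t₁ - s) * ξ ^ 2) / 2)) ^ 2 *
          |ξ| ^ (1 - 2 * H)) ≤
      ENNReal.ofReal κ⁻¹ * ENNReal.ofReal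
        (min 1 (κ * (t₂ - t₁) * |ξ| ^ 2) * |ξ| ^ (-1 - 2 * H)) := by
  rcases eq_or_ne ξ 0 with rfl | hξ
  · simp
  have hξ0 : 0 < |ξ| := abs_pos.mpr hξ
  have hδ : 0 ≤ t₂ - t₁ := sub_nonneg.mpr ht
  set x : ℝ := κ * (t₂ - t₁) * ξ ^ 2 / 2 with hx
  have hx0 : 0 ≤ x := by positivity
  have hfactor (s : ℝ) :
      (exp (-(κ * (t₂ - s) * ξ ^ 2) / 2) - exp (-(κ * (t₁ - s) * ξ ^ 2) / 2)) ^ 2 *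
          |ξ| ^ (1 - 2 * H) =
        ((1 - exp (-x)) ^ 2 * |ξ| ^ (1 - 2 * H)) * exp (-(κ * ξ ^ 2 * (t₁ - s))) := by
    have h₂ : exp (-(κ * (t₂ - s) * ξ ^ 2) / 2) =
        exp (-(κ * (t₁ - s) * ξ ^ 2) / 2) * exp (-x) := by
      rw [← exp_add, hx]
      ring_nf
    have h₁ : exp (-(κ * ξ ^ 2 * (t₁ - s))) = exp (-(κ * (t₁ - s) * ξ ^ 2) / 2) ^ 2 := by
      rw [← exp_nat_mul]
      push_cast
      ring_nf
    rw [h₁, h₂]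
    ring
  have hA : 0 ≤ (1 - exp (-x)) ^ 2 * |ξ| ^ (1 - 2 * H) := by positivity
  simp_rw [hfactor, ENNReal.ofReal_mul hA]
  rw [lintegral_const_mul' _ _ ENNReal.ofReal_ne_top]
  refine (mul_le_mul_right (setLIntegral_exp_neg_mul_sub_le (by positivity) t₁) _).trans ?_
  rw [← ENNReal.ofReal_mul hA, ← ENNReal.ofReal_mul (inv_pos.mpr hκ).le]
  refine ENNReal.ofReal_le_ofReal ?_
  have hpow : |ξ| ^ (1 - 2 * H) = ξ ^ 2 * |ξ| ^ (-1 - 2 * H) := by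
    rw [← sq_abs, ← rpow_natCast, ← rpow_add hξ0]
    norm_num
    ring_nf
  have hmin : (1 - exp (-x)) ^ 2 ≤ min 1 (κ * (t₂ - t₁) * |ξ| ^ 2) :=
    (one_sub_exp_neg_sq_le_min hx0).trans <| min_le_min_left _ <| by
      rw [sq_abs, hx]
      exact half_le_self (by positivity)
  calc (1 - exp (-x)) ^ 2 * |ξ| ^ (1 - 2 * H) * (κ * ξ ^ 2)⁻¹
      = κ⁻¹ * ((1 - exp (-x)) ^ 2 * |ξ| ^ (-1 - 2 * H)) := by
        rw [hpow]
        field_simp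
    _ ≤ _ := by gcongr

/-- For `H ∈ (0,1/2)` there is a finite constant `C_H`, depending only on `H`, such that
for every `κ > 0` and all `0 ≤ t₁ ≤ t₂`,
`∫_0^{t₁} ∫_ℝ (e^{-κ(t₂-s)ξ²/2} - e^{-κ(t₁-s)ξ²/2})² |ξ|^{1-2H} dξ ds
  ≤ C_H κ^{H-1} (t₂ - t₁)^H`. -/
theorem stmt_19 (H : ℝ) (hH : H ∈ Set.Ioo (0:ℝ) (1/2)) :
    ∃ C : ℝ, 0 < C ∧ ∀ κ : ℝ, 0 < κ → ∀ t₁ t₂ : ℝ, 0 ≤ t₁ → t₁ ≤ t₂ →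
      (∫⁻ s in Set.Icc 0 t₁, ∫⁻ ξ : ℝ, ENNReal.ofReal
          ((Real.exp (-(κ * (t₂ - s) * ξ ^ 2) / 2) -
            Real.exp (-(κ * (t₁ - s) * ξ ^ 2) / 2)) ^ 2 * |ξ| ^ (1 - 2 * H)))
        ≤ ENNReal.ofReal (C * κ ^ (H - 1) * (t₂ - t₁) ^ H) := by
  obtain ⟨hH0, hH1⟩ := hH
  have hD : 0 < 1 / (2 - 2 * H) + 1 / (2 * H) :=
    add_pos (one_div_pos.mpr (by linarith)) (by positivity)
  refine ⟨2 * (1 / (2 - 2 * H) + 1 / (2 * H)), by positivity, fun κ hκ t₁ t₂ _ ht => ?_⟩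
  rcases ht.eq_or_lt with rfl | hlt
  · simp
  have hδ : 0 < t₂ - t₁ := sub_pos.mpr hlt
  rw [lintegral_lintegral_swap (by
    apply Measurable.aemeasurable
    unfold Function.uncurry
    fun_prop)]
  refine (lintegral_mono (setLIntegral_exp_sub_exp_sq_le hκ ht)).trans ?_
  rw [lintegral_const_mul' _ _ ENNReal.ofReal_ne_top, lintegral_comp_abs_eq_two_mul
    (fun r => ENNReal.ofReal (min 1 (κ * (t₂ - t₁) * r ^ 2) * r ^ (-1 - 2 * H)))]
  calc ENNReal.ofReal κ⁻¹ * (2 * ∫⁻ r in Set.Ioi (0 : ℝ),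
          ENNReal.ofReal (min 1 (κ * (t₂ - t₁) * r ^ 2) * r ^ (-1 - 2 * H)))
      ≤ ENNReal.ofReal κ⁻¹ * (ENNReal.ofReal 2 *
          ENNReal.ofReal ((1 / (2 - 2 * H) + 1 / (2 * H)) * (κ * (t₂ - t₁)) ^ H)) := by
        rw [ENNReal.ofReal_ofNat]
        gcongr
        exact setLIntegral_min_one_mul_rpow_le hH0 (by linarith) (mul_pos hκ hδ)
    _ = _ := by
        rw [← ENNReal.ofReal_mul zero_le_two, ← ENNReal.ofReal_mul (inv_pos.mpr hκ).le,
          mul_rpow hκ.le hδ.le, rpow_sub hκ, rpow_one]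
        congr 1
        ring
end
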